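/- arXiv:1211.6910 — 7 statements merged into one kernel-verified Lean document; each statement's English description precedes it below -/
import Mathlib

section
/- T′ · A · ᵗT′ = J_g, where J_g is the 2g×2g block-diagonal matrix with g diagonal blocks each equal to [[0,1],[−1,0]]. (Equivalently, the chord-slide moves f_{g−1}∘⋯∘f_1 transform the intersection matrix A into J_g.) -/
open Finset

/-- The entries of the chord-slide matrix, as a function of two natural numbers. -/
def chordEntry (i j : ℕ) : ℤ :=
  if i % 2 = 0 then (if j ≤ i then (-1) ^ j else 0)
  else (if j + 2 ≤ i then (-1) ^ j else if j = i then 1 else 0)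

theorem neg_one_pow_eq_one_sub_two_mul_mod (n : ℕ) : (-1 : ℤ) ^ n = 1 - 2 * (n % 2 : ℕ) := by
  rw [neg_one_pow_eq_pow_mod_two]
  rcases Nat.mod_two_eq_zero_or_one n with h | h <;> simp [h]

theorem sum_range_chordEntry (i n : ℕ) :
    ∑ j ∈ range n, chordEntry i j =
      if i < n then 1 else if i % 2 = 1 ∧ n = i then 0 else ((n % 2 : ℕ) : ℤ) := by
  induction n with
  | zero => simp
  | succ n ih =>
    rw [sum_range_succ, ih, chordEntry, neg_one_pow_eq_one_sub_two_mul_mod]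
    split_ifs <;> lia

theorem sum_range_mul_sign (f : ℕ → ℤ) {l N : ℕ} (h : l + 1 ≤ N) :
    ∑ j ∈ range N, f j * (if j < l then 1 else if j = l then 0 else -1) =
      ∑ j ∈ range l, f j + ∑ j ∈ range (l + 1), f j - ∑ j ∈ range N, f j := by
  induction N, h using Nat.le_induction with
  | base =>
    rw [sum_range_succ]
    have : ∀ j ∈ range l, f j * (if j < l then 1 else if j = l then 0 else -1) = f j := by
      intro j hj
      simp [mem_range.1 hj]
    rw [sum_congr rfl this]
    simp
  | succ N h ih =>
    rw [sum_range_succ, ih, sum_range_succ f N, if_neg (by lia), if_neg (by lia)]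
    ring

theorem sum_range_ite_lt_mul (f : ℕ → ℤ) {i N : ℕ} (h : i + 1 ≤ N) :
    ∑ l ∈ range N, (if i < l then 1 else 0) * f l =
      ∑ l ∈ range N, f l - ∑ l ∈ range (i + 1), f l := by
  induction N, h using Nat.le_induction with
  | base =>
    rw [sub_self]
    refine sum_eq_zero fun l hl => ?_
    rw [if_neg (by have := mem_range.1 hl; lia), zero_mul]
  | succ N h ih =>
    rw [sum_range_succ, ih, sum_range_succ f N, if_pos (by lia)]
    ring

theorem sum_range_chordEntry_mul_sign {i l N : ℕ} (hi : i < N) (hl : l < N) :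
    ∑ j ∈ range N, chordEntry i j * (if j < l then 1 else if j = l then 0 else -1) =
      (if i < l then 1 else 0) - (if i % 2 = 1 ∧ l = i - 1 then 1 else 0) := by
  rw [sum_range_mul_sign _ hl]
  simp only [sum_range_chordEntry]
  split_ifs <;> lia

theorem sum_range_mul_chordEntry {i k N : ℕ} (hi : i < N) (hk : k < N) :
    ∑ l ∈ range N, ((if i < l then 1 else 0) - (if i % 2 = 1 ∧ l = i - 1 then 1 else 0)) *
        chordEntry k l =
      if i % 2 = 0 ∧ k = i + 1 then 1 else if k % 2 = 0 ∧ i = k + 1 then -1 else 0 := by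
  simp only [sub_mul, sum_sub_distrib]
  rw [sum_range_ite_lt_mul _ hi]
  have : ∑ l ∈ range N, (if i % 2 = 1 ∧ l = i - 1 then 1 else 0) * chordEntry k l =
      if i % 2 = 1 then chordEntry k (i - 1) else 0 := by
    split_ifs with h
    · simp [h, show i - 1 < N by lia]
    · simp [h]
  rw [this]
  simp only [sum_range_chordEntry]
  simp only [chordEntry, neg_one_pow_eq_one_sub_two_mul_mod]
  split_ifs <;> lia

/-- The chord-slide moves transform the intersection matrix `A` (with `A_{ij} = 1` for
`i < j`, `0` for `i = j`, `-1` for `i > j`) into the block-diagonal matrix `J_g` with `g`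
blocks `[[0,1],[-1,0]]`: explicitly `T′ A ᵗT′ = J_g`, where the rows of `T′` are given by
the alternating pattern described in the paper (indices below are 0-based). -/
theorem chord_slide_Tprime (g : ℕ) (hg : 2 ≤ g)
    (A T' J : Matrix (Fin (2 * g)) (Fin (2 * g)) ℤ)
    (hA : ∀ i j, A i j = if (i : ℕ) < (j : ℕ) then 1 else if i = j then 0 else -1)
    (hT' : ∀ i j, T' i j =
      if (i : ℕ) % 2 = 0 then
        (if (j : ℕ) ≤ (i : ℕ) then (-1) ^ (j : ℕ) else 0)
      else
        (if (j : ℕ) + 2 ≤ (i : ℕ) then (-1) ^ (j : ℕ)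
         else if (j : ℕ) = (i : ℕ) then 1 else 0))
    (hJ : ∀ i j, J i j =
      if (i : ℕ) % 2 = 0 ∧ (j : ℕ) = (i : ℕ) + 1 then 1
      else if (j : ℕ) % 2 = 0 ∧ (i : ℕ) = (j : ℕ) + 1 then -1 else 0) :
    T' * A * T'.transpose = J := by
  have hTA : ∀ i l, (T' * A) i l = (if (i : ℕ) < l then 1 else 0) -
      (if (i : ℕ) % 2 = 1 ∧ (l : ℕ) = i - 1 then 1 else 0) := by
    intro i l
    rw [← sum_range_chordEntry_mul_sign i.2 l.2, ← Fin.sum_univ_eq_sum_range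
      (fun j => chordEntry i j * (if j < l then 1 else if j = l then 0 else -1)),
      Matrix.mul_apply]
    refine sum_congr rfl fun j _ => ?_
    simp only [hT', hA, chordEntry, Fin.ext_iff]
  ext i k
  rw [hJ, ← sum_range_mul_chordEntry i.2 k.2, ← Fin.sum_univ_eq_sum_range
    (fun l => ((if (i : ℕ) < l then 1 else 0) -
      (if (i : ℕ) % 2 = 1 ∧ l = i - 1 then 1 else 0)) * chordEntry k l), Matrix.mul_apply]
  refine sum_congr rfl fun l _ => ?_
  rw [hTA, Matrix.transpose_apply, hT', chordEntry]
end

section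
/- K · A · ᵗK = J, where J is the 2g×2g matrix written in g×g blocks as [[0, I_g], [−I_g, 0]]. (Equivalently, the natural-type basis {A_i, B_i}, expressed in the loops c_1, …, c_{2g} by the rows of K, is a symplectic basis of the first homology of the hyperelliptic curve w² = z^{2g+1} − 1.) -/
open Finset

theorem neg_one_pow_succ_eq_mod (n : ℕ) : (-1 : ℤ) ^ (n + 1) = 2 * (n % 2 : ℕ) - 1 := by
  rcases Nat.even_or_odd n with h | h
  · rw [h.add_one.neg_one_pow, Nat.even_iff.mp h]; norm_num
  · rw [h.add_one.neg_one_pow, Nat.odd_iff.mp h]; norm_num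

theorem sum_range_consecutive_difference (f : ℕ → ℤ) {i n : ℕ} (h : 2 * i + 1 < n) :
    ∑ j ∈ range n, (if j = 2 * i then -1 else if j = 2 * i + 1 then 1 else 0) * f j =
      f (2 * i + 1) - f (2 * i) := by
  have key : ∀ n, ∑ j ∈ range n,
      (if j = 2 * i then -1 else if j = 2 * i + 1 then 1 else 0) * f j =
      (if 2 * i + 1 < n then f (2 * i + 1) else 0) - (if 2 * i < n then f (2 * i) else 0) := by
    intro n
    induction n with
    | zero => simp
    | succ n ih => rw [sum_range_succ, ih]; grind
  rw [key, if_pos h, if_pos (by lia)]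

theorem sum_range_alternating_mul_sign {m k n : ℕ} (h : 2 * m < n) :
    ∑ j ∈ range n, (if j ≤ 2 * m then (-1 : ℤ) ^ (j + 1) else 0) *
      (if j < k then 1 else if j = k then 0 else -1) = if 2 * m < k then -1 else 0 := by
  have key : ∀ n, ∑ j ∈ range n, (if j ≤ 2 * m then (-1 : ℤ) ^ (j + 1) else 0) *
      (if j < k then 1 else if j = k then 0 else -1) =
      if min n (2 * m + 1) ≤ k then -((min n (2 * m + 1) % 2 : ℕ) : ℤ)
      else ((min n (2 * m + 1) % 2 : ℕ) : ℤ) - 1 := by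
    intro n
    induction n with
    | zero => simp
    | succ n ih =>
      rw [sum_range_succ, ih, neg_one_pow_succ_eq_mod]
      split_ifs <;> omega
  rw [key]
  split_ifs <;> omega

theorem sum_range_alternating_mul_tail {m p n : ℕ} (h : 2 * p < n) :
    ∑ k ∈ range n, (if k ≤ 2 * p then (-1 : ℤ) ^ (k + 1) else 0) *
      (if 2 * m < k then -1 else 0) = 0 := by
  have key : ∀ n, ∑ k ∈ range n, (if k ≤ 2 * p then (-1 : ℤ) ^ (k + 1) else 0) *
      (if 2 * m < k then -1 else 0) =
      if min n (2 * p + 1) ≤ 2 * m + 1 then 0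
      else -(((min n (2 * p + 1) + 1) % 2 : ℕ) : ℤ) := by
    intro n
    induction n with
    | zero => simp
    | succ n ih =>
      rw [sum_range_succ, ih, neg_one_pow_succ_eq_mod]
      split_ifs <;> omega
  rw [key]
  split_ifs <;> omega

/-- `K A ᵗK = J` where `J = [[0, I_g], [-I_g, 0]]`: the natural-type basis `{A_i, B_i}`,
expressed in the loops `c₁, …, c_{2g}` by the rows of `K`, is a symplectic basis of the
first homology of the hyperelliptic curve `w² = z^{2g+1} - 1` (indices below 0-based). -/
theorem natural_basis_symplectic_K (g : ℕ) (hg : 2 ≤ g)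
    (A K J : Matrix (Fin (2 * g)) (Fin (2 * g)) ℤ)
    (hA : ∀ i j, A i j = if (i : ℕ) < (j : ℕ) then 1 else if i = j then 0 else -1)
    (hK : ∀ i j, K i j =
      if (i : ℕ) < g then
        (if (j : ℕ) = 2 * (i : ℕ) then -1
         else if (j : ℕ) = 2 * (i : ℕ) + 1 then 1 else 0)
      else
        (if (j : ℕ) ≤ 2 * ((i : ℕ) - g) then (-1) ^ ((j : ℕ) + 1) else 0))
    (hJ : ∀ i j, J i j =
      if (i : ℕ) < g ∧ (j : ℕ) = (i : ℕ) + g then 1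
      else if (j : ℕ) < g ∧ (i : ℕ) = (j : ℕ) + g then -1 else 0) :
    K * A * K.transpose = J := by
  have hKA : ∀ i k, (K * A) i k =
      if (i : ℕ) < g then
        (if (k : ℕ) = 2 * (i : ℕ) ∨ (k : ℕ) = 2 * (i : ℕ) + 1 then -1 else 0)
      else if 2 * ((i : ℕ) - g) < (k : ℕ) then -1 else 0 := by
    intro i k
    simp only [Matrix.mul_apply, hK, hA, Fin.ext_iff]
    by_cases hi : (i : ℕ) < g
    · simp only [hi, if_true]
      rw [Fin.sum_univ_eq_sum_range (fun j =>
        (if j = 2 * (i : ℕ) then (-1 : ℤ) else if j = 2 * (i : ℕ) + 1 then 1 else 0) *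
          (if j < (k : ℕ) then 1 else if j = (k : ℕ) then 0 else -1)) (2 * g),
        sum_range_consecutive_difference _ (by lia)]
      split_ifs <;> omega
    · simp only [hi, if_false]
      rw [Fin.sum_univ_eq_sum_range (fun j =>
        (if j ≤ 2 * ((i : ℕ) - g) then (-1 : ℤ) ^ (j + 1) else 0) *
          (if j < (k : ℕ) then 1 else if j = (k : ℕ) then 0 else -1)) (2 * g),
        sum_range_alternating_mul_sign (by lia)]
  ext i l
  rw [Matrix.mul_apply, hJ]
  simp only [Matrix.transpose_apply, hKA, hK, mul_comm (ite ((i : ℕ) < g) _ _)]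
  by_cases hl : (l : ℕ) < g
  · simp only [hl, if_true, true_and]
    rw [Fin.sum_univ_eq_sum_range (fun k =>
      (if k = 2 * (l : ℕ) then (-1 : ℤ) else if k = 2 * (l : ℕ) + 1 then 1 else 0) *
        (if (i : ℕ) < g then (if k = 2 * (i : ℕ) ∨ k = 2 * (i : ℕ) + 1 then -1 else 0)
          else if 2 * ((i : ℕ) - g) < k then -1 else 0)) (2 * g),
      sum_range_consecutive_difference _ (by lia)]
    split_ifs <;> omega
  · simp only [hl, if_false]
    by_cases hi : (i : ℕ) < g
    · simp only [hi, if_true]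
      have hrow : ∀ k : ℕ, (if k = 2 * (i : ℕ) ∨ k = 2 * (i : ℕ) + 1 then (-1 : ℤ) else 0) =
          (if k = 2 * (i : ℕ) then -1 else if k = 2 * (i : ℕ) + 1 then 1 else 0) *
            (-1) ^ k := by
        intro k
        have := neg_one_pow_succ_eq_mod k
        rw [pow_succ] at this
        split_ifs <;> omega
      simp only [hrow, mul_comm (ite (_ ≤ _) _ _), mul_assoc]
      rw [Fin.sum_univ_eq_sum_range (fun k =>
        (if k = 2 * (i : ℕ) then (-1 : ℤ) else if k = 2 * (i : ℕ) + 1 then 1 else 0) *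
          ((-1) ^ k * if k ≤ 2 * ((l : ℕ) - g) then (-1) ^ (k + 1) else 0)) (2 * g),
        sum_range_consecutive_difference _ (by lia)]
      simp only [pow_succ, pow_mul]
      norm_num
      split_ifs <;> omega
    · simp only [hi, if_false]
      rw [Fin.sum_univ_eq_sum_range (fun k =>
        (if k ≤ 2 * ((l : ℕ) - g) then (-1 : ℤ) ^ (k + 1) else 0) *
          (if 2 * ((i : ℕ) - g) < k then -1 else 0)) (2 * g),
        sum_range_alternating_mul_tail (by lia)]
      split_ifs <;> omega
end

section
/- The matrix ᵗK is invertible over ℤ and (ᵗK)^{−1} · ᵗT = H, where H is the 2g×2g matrix written in g×g blocks as [[0, I_g], [−I_g, −I_g]]; moreover H is symplectic, i.e. ᵗH · J · H = J where J = [[0, I_g], [−I_g, 0]]. -/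
open Finset

/-- Right multiplication by `[[0, I], [-I, -I]]` acts on columns. -/
lemma mul_apply_of_block_entries {g : ℕ} {H : Matrix (Fin (2 * g)) (Fin (2 * g)) ℤ}
    (hH : ∀ i j, H i j =
      if (i : ℕ) < g then (if (j : ℕ) = (i : ℕ) + g then 1 else 0)
      else (if (j : ℕ) = (i : ℕ) - g then -1 else if j = i then -1 else 0))
    (A : Matrix (Fin (2 * g)) (Fin (2 * g)) ℤ) (i j : Fin (2 * g)) :
    (A * H) i j = if h : (j : ℕ) < g then -A i ⟨j + g, by omega⟩
      else A i ⟨j - g, by omega⟩ - A i j := by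
  rw [Matrix.mul_apply]
  split_ifs with h
  · rw [Finset.sum_eq_single ⟨j + g, by omega⟩]
    · simp [hH]
    · intro k _ hk
      have hk' : (k : ℕ) ≠ j + g := fun e => hk (Fin.ext e)
      rw [hH]
      simp only [Fin.ext_iff]
      split_ifs <;> omega
    · simp
  · have key : ∀ k, A i k * H k j =
        (if k = ⟨j - g, by omega⟩ then A i k else 0) - (if k = j then A i k else 0) := by
      intro k
      rw [hH]
      simp only [Fin.ext_iff]
      split_ifs <;> omega
    simp [key, Finset.sum_sub_distrib]

/-- A square matrix is a unit if every standard basis vector is in its row span. -/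
lemma isUnit_of_forall_single_mem_range {n R : Type*} [Fintype n] [DecidableEq n] [CommRing R]
    {A : Matrix n n R} (h : ∀ j, Pi.single j 1 ∈ LinearMap.range A.vecMulLinear) :
    IsUnit A := by
  rw [← Matrix.vecMul_surjective_iff_isUnit]
  have htop : LinearMap.range A.vecMulLinear = ⊤ := by
    rw [eq_top_iff, ← (Pi.basisFun R n).span_eq, Submodule.span_le]
    rintro _ ⟨j, rfl⟩
    simpa using h j
  exact LinearMap.range_eq_top.mp htop

/-- The change-of-basis matrix `K` is invertible over `ℤ`. -/
lemma isUnit_of_chain_entries {g : ℕ} {K : Matrix (Fin (2 * g)) (Fin (2 * g)) ℤ}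
    (hK : ∀ i j, K i j =
      if (i : ℕ) < g then
        (if (j : ℕ) = 2 * (i : ℕ) then -1
         else if (j : ℕ) = 2 * (i : ℕ) + 1 then 1 else 0)
      else
        (if (j : ℕ) ≤ 2 * ((i : ℕ) - g) then (-1) ^ ((j : ℕ) + 1) else 0)) :
    IsUnit K := by
  apply isUnit_of_forall_single_mem_range
  have hrow : ∀ i, K i ∈ LinearMap.range K.vecMulLinear := fun i =>
    ⟨Pi.single i 1, by simp [Matrix.row]⟩
  suffices h : ∀ (n : ℕ) (hn : n < 2 * g),
      (Pi.single ⟨n, hn⟩ 1 : Fin (2 * g) → ℤ) ∈ LinearMap.range K.vecMulLinear from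
    fun j => h j j.2
  intro n
  induction n with
  | zero =>
    intro hn
    have e : (Pi.single ⟨0, hn⟩ 1 : Fin (2 * g) → ℤ) = -K ⟨g, by omega⟩ := by
      ext j
      simp only [Pi.neg_apply, hK, Pi.single_apply, Fin.ext_iff]
      split_ifs <;> first | omega | simp_all
    rw [e]
    exact neg_mem (hrow _)
  | succ n ih =>
    intro hn
    have ih := ih (by omega)
    obtain ⟨i, rfl | rfl⟩ := n.even_or_odd'
    · have e : (Pi.single ⟨2 * i + 1, hn⟩ 1 : Fin (2 * g) → ℤ) =
          K ⟨i, by omega⟩ + Pi.single ⟨2 * i, by omega⟩ 1 := by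
        ext j
        simp only [Pi.add_apply, hK, Pi.single_apply, Fin.ext_iff]
        split_ifs <;> omega
      rw [e]
      exact add_mem (hrow _) ih
    · have e : (Pi.single ⟨2 * i + 1 + 1, hn⟩ 1 : Fin (2 * g) → ℤ) =
          K ⟨g + i, by omega⟩ - K ⟨g + (i + 1), by omega⟩ + Pi.single ⟨2 * i + 1, by omega⟩ 1 := by
        ext j
        have h1 : (j : ℕ) = 2 * i + 1 → (-1 : ℤ) ^ ((j : ℕ) + 1) = 1 := fun h =>
          Even.neg_one_pow ⟨i + 1, by omega⟩
        have h2 : (j : ℕ) = 2 * i + 1 + 1 → (-1 : ℤ) ^ ((j : ℕ) + 1) = -1 := fun h =>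
          Odd.neg_one_pow ⟨i + 1, by omega⟩
        simp only [Pi.add_apply, Pi.sub_apply, hK, Pi.single_apply, Fin.ext_iff]
        split_ifs <;> omega
      rw [e]
      exact add_mem (sub_mem (hrow _) (hrow _)) ih

/-- `ᵗK` is invertible over `ℤ` and `(ᵗK)⁻¹ ᵗT = H`, where
`H = [[0, I_g], [-I_g, -I_g]]`; moreover `H` is symplectic: `ᵗH J H = J` with
`J = [[0, I_g], [-I_g, 0]]` (indices below are 0-based). -/
theorem change_of_basis_H (g : ℕ) (hg : 2 ≤ g)
    (T K H J : Matrix (Fin (2 * g)) (Fin (2 * g)) ℤ)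
    (hT : ∀ i j, T i j =
      if (i : ℕ) < g then
        (if (j : ℕ) ≤ 2 * (i : ℕ) then (-1) ^ (j : ℕ) else 0)
      else
        (if (j : ℕ) < 2 * ((i : ℕ) - g) then (-1) ^ (j : ℕ)
         else if (j : ℕ) = 2 * ((i : ℕ) - g) + 1 then 1 else 0))
    (hK : ∀ i j, K i j =
      if (i : ℕ) < g then
        (if (j : ℕ) = 2 * (i : ℕ) then -1
         else if (j : ℕ) = 2 * (i : ℕ) + 1 then 1 else 0)
      else
        (if (j : ℕ) ≤ 2 * ((i : ℕ) - g) then (-1) ^ ((j : ℕ) + 1) else 0))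
    (hH : ∀ i j, H i j =
      if (i : ℕ) < g then (if (j : ℕ) = (i : ℕ) + g then 1 else 0)
      else (if (j : ℕ) = (i : ℕ) - g then -1 else if j = i then -1 else 0))
    (hJ : ∀ i j, J i j =
      if (i : ℕ) < g ∧ (j : ℕ) = (i : ℕ) + g then 1
      else if (j : ℕ) < g ∧ (i : ℕ) = (j : ℕ) + g then -1 else 0) :
    IsUnit K.transpose ∧ K.transpose⁻¹ * T.transpose = H ∧
      H.transpose * J * H = J := by
  have hKu : IsUnit K.transpose := (Matrix.isUnit_transpose K).mpr (isUnit_of_chain_entries hK)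
  have hmul := mul_apply_of_block_entries hH
  refine ⟨hKu, ?_, ?_⟩
  · have hTH : T.transpose = K.transpose * H := by
      ext i j
      rw [hmul]
      simp only [Matrix.transpose_apply, hT, hK]
      have h1 : (i : ℕ) = 2 * ((j : ℕ) - g) → (-1 : ℤ) ^ (i : ℕ) = 1 := fun h =>
        Even.neg_one_pow ⟨(j : ℕ) - g, by omega⟩
      simp only [pow_succ]
      split_ifs <;> omega
    rw [hTH, Matrix.nonsing_inv_mul_cancel_left _ _ ((Matrix.isUnit_iff_isUnit_det _).mp hKu)]
  · have hHJ : H.transpose * J = (J.transpose * H).transpose := by simp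
    ext i j
    rw [hHJ, hmul]
    simp only [Matrix.transpose_apply, hmul, hJ]
    split_ifs <;> omega
end

section
/- Write M · ᵗK = (Ω_A | Ω_B) and M · ᵗT = (A′ | B′), where Ω_A, Ω_B, A′, B′ are the left and right g×g blocks of the respective products. Then Ω_A, Ω_B and A′ are invertible, and A′^{−1} B′ = −(Ω_A^{−1} Ω_B)^{−1} + I_g. (That is, the period matrix τ_g^{CS} of y^{2g+1} = x(1−x) with respect to the chord-slide symplectic basis satisfies τ_g^{CS} = −τ_g^{−1} + I_g.) -/
open Finset

theorem sum_range_alternating_one_sub_pow {R : Type*} [CommRing R] (x : R) (n : ℕ) :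
    ∑ l ∈ range (2 * n + 1), (1 - x ^ (l + 1)) * (-1) ^ (l + 1) =
      (x - 1) * ∑ k ∈ range (n + 1), (x ^ 2) ^ k := by
  induction n with
  | zero => simp
  | succ n ih =>
    rw [show 2 * (n + 1) + 1 = 2 * n + 1 + 1 + 1 by ring, sum_range_succ, sum_range_succ, ih,
      sum_range_succ _ (n + 1)]
    ring_nf
    simp only [mul_comm n 2, pow_mul, neg_one_sq, one_pow]
    ring

theorem sum_fin_ite_lt_eq_sum_range {R : Type*} [AddCommMonoid R] {m n : ℕ} (h : m ≤ n)
    (f : ℕ → R) : (∑ l : Fin n, if (l : ℕ) < m then f l else 0) = ∑ l ∈ range m, f l := by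
  rw [Fin.sum_univ_eq_sum_range (fun l => if l < m then f l else 0), ← sum_filter]
  congr 1
  ext a
  simp only [mem_filter, mem_range]
  omega

/-- The upper triangular matrix of ones is unimodular. -/
theorem det_upperTriangular_one {R : Type*} [CommRing R] (n : ℕ) :
    (Matrix.of fun i j : Fin n => if i ≤ j then (1 : R) else 0).det = 1 := by
  rw [Matrix.det_of_isUpperTriangular]
  · simp
  · intro i j hij
    simp only [id] at hij
    simp [not_le.mpr hij]

theorem inv_neg_mul_neg_add {n R : Type*} [Fintype n] [DecidableEq n] [CommRing R]
    (A B : Matrix n n R) (hA : IsUnit A) (hB : IsUnit B) :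
    (-B)⁻¹ * (-B + A) = -(A⁻¹ * B)⁻¹ + 1 := by
  have hA' := (Matrix.isUnit_iff_isUnit_det A).mp hA
  have hnB := (Matrix.isUnit_iff_isUnit_det (-B)).mp hB.neg
  have hB' := (Matrix.isUnit_iff_isUnit_det B).mp hB
  have hinv : (-B)⁻¹ = -B⁻¹ := Matrix.inv_eq_left_inv (by
    rw [neg_mul_neg, Matrix.nonsing_inv_mul _ hB'])
  rw [mul_add, Matrix.nonsing_inv_mul _ hnB, hinv, Matrix.mul_inv_rev,
    Matrix.nonsing_inv_nonsing_inv _ hA', neg_mul, add_comm]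

/-- Writing `M ᵗK = (Ω_A | Ω_B)` and `M ᵗT = (A′ | B′)` (blockwise), the matrices
`Ω_A`, `Ω_B`, `A′` are invertible and `A′⁻¹ B′ = -(Ω_A⁻¹ Ω_B)⁻¹ + I_g`: the period
matrix of `y^{2g+1} = x(1-x)` w.r.t. the chord-slide basis satisfies
`τ_g^CS = -τ_g⁻¹ + I_g` (indices below are 0-based). -/
theorem period_matrix_relation (g : ℕ) (hg : 2 ≤ g)
    (ζ : ℂ) (hζ : ζ = Complex.exp (2 * Real.pi * Complex.I / (2 * g + 1)))
    (M : Matrix (Fin g) (Fin (2 * g)) ℂ)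
    (hM : ∀ i j, M i j = 1 - ζ ^ (((i : ℕ) + 1) * ((j : ℕ) + 1)))
    (T K : Matrix (Fin (2 * g)) (Fin (2 * g)) ℤ)
    (hT : ∀ i j, T i j =
      if (i : ℕ) < g then
        (if (j : ℕ) ≤ 2 * (i : ℕ) then (-1) ^ (j : ℕ) else 0)
      else
        (if (j : ℕ) < 2 * ((i : ℕ) - g) then (-1) ^ (j : ℕ)
         else if (j : ℕ) = 2 * ((i : ℕ) - g) + 1 then 1 else 0))
    (hK : ∀ i j, K i j =
      if (i : ℕ) < g then
        (if (j : ℕ) = 2 * (i : ℕ) then -1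
         else if (j : ℕ) = 2 * (i : ℕ) + 1 then 1 else 0)
      else
        (if (j : ℕ) ≤ 2 * ((i : ℕ) - g) then (-1) ^ ((j : ℕ) + 1) else 0))
    (ΩA ΩB A' B' : Matrix (Fin g) (Fin g) ℂ)
    (hΩA : ∀ i j : Fin g, ΩA i j =
      ∑ l, M i l * ((K ⟨(j : ℕ), by have := j.isLt; omega⟩ l : ℤ) : ℂ))
    (hΩB : ∀ i j : Fin g, ΩB i j =
      ∑ l, M i l * ((K ⟨g + (j : ℕ), by have := j.isLt; omega⟩ l : ℤ) : ℂ))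
    (hA' : ∀ i j : Fin g, A' i j =
      ∑ l, M i l * ((T ⟨(j : ℕ), by have := j.isLt; omega⟩ l : ℤ) : ℂ))
    (hB' : ∀ i j : Fin g, B' i j =
      ∑ l, M i l * ((T ⟨g + (j : ℕ), by have := j.isLt; omega⟩ l : ℤ) : ℂ)) :
    IsUnit ΩA ∧ IsUnit ΩB ∧ IsUnit A' ∧
      A'⁻¹ * B' = -(ΩA⁻¹ * ΩB)⁻¹ + 1 := by
  have hprim : IsPrimitiveRoot ζ (2 * g + 1) := by
    have h := Complex.isPrimitiveRoot_exp (2 * g + 1) (by omega)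
    push_cast at h
    rwa [← hζ] at h
  let x : Fin g → ℂ := fun i => ζ ^ ((i : ℕ) + 1)
  let V : Matrix (Fin g) (Fin g) ℂ := Matrix.vandermonde fun i => x i ^ 2
  have hx0 : ∀ i, x i ≠ 0 := fun i => pow_ne_zero _ (hprim.ne_zero (by omega))
  have hx1 : ∀ i, x i - 1 ≠ 0 := fun i =>
    sub_ne_zero.mpr (hprim.pow_ne_one_of_pos_of_lt (by omega) (by omega))
  have hV : V.det ≠ 0 := by
    refine Matrix.det_vandermonde_ne_zero_iff.mpr fun i j hij => ?_
    simp only [x, ← pow_mul] at hij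
    have := hprim.pow_inj (by omega) (by omega) hij
    omega
  have hMx : ∀ i j, M i j = 1 - x i ^ ((j : ℕ) + 1) := fun i j => by
    rw [hM, pow_mul]
  have eB : ΩB = Matrix.diagonal (fun i => x i - 1) *
      (V * Matrix.of fun i j : Fin g => if i ≤ j then (1 : ℂ) else 0) := by
    ext i j
    rw [Matrix.diagonal_mul, Matrix.mul_apply, hΩB]
    have hL : ∀ l : Fin (2 * g), M i l * ((K ⟨g + (j : ℕ), by omega⟩ l : ℤ) : ℂ) =
        if (l : ℕ) < 2 * (j : ℕ) + 1 then
          (1 - x i ^ ((l : ℕ) + 1)) * (-1) ^ ((l : ℕ) + 1) else 0 := by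
      intro l
      rw [hMx, hK]
      simp
    have hR : ∀ k : Fin g,
        V i k * Matrix.of (fun i j : Fin g => if i ≤ j then (1 : ℂ) else 0) k j =
          if (k : ℕ) < (j : ℕ) + 1 then (x i ^ 2) ^ (k : ℕ) else 0 := by
      intro k
      simp [V, Matrix.vandermonde_apply]
    rw [sum_congr rfl fun l _ => hL l, sum_congr rfl fun k _ => hR k,
      sum_fin_ite_lt_eq_sum_range (by omega)
        fun l => (1 - x i ^ (l + 1)) * (-1) ^ (l + 1),
      sum_fin_ite_lt_eq_sum_range (by omega) fun k => (x i ^ 2) ^ k,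
      sum_range_alternating_one_sub_pow]
  have eA : ΩA = Matrix.diagonal (fun i => x i * (1 - x i)) * V := by
    ext i j
    rw [Matrix.diagonal_mul, hΩA, ← sum_subset
      (subset_univ {(⟨2 * j, by omega⟩ : Fin (2 * g)), ⟨2 * j + 1, by omega⟩})]
    · rw [sum_pair (by simp)]
      simp only [hMx, hK, V, Matrix.vandermonde_apply]
      simp
      ring
    · intro l _ hl
      simp only [mem_insert, mem_singleton, Fin.ext_iff, not_or] at hl
      simp [hK, hl.1, hl.2]
  have eA' : A' = -ΩB := by
    ext i j
    rw [Matrix.neg_apply, hA', hΩB, ← sum_neg_distrib]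
    refine sum_congr rfl fun l _ => ?_
    rw [hT, hK]
    simp [pow_succ]
    split_ifs <;> simp
  have eB' : B' = -ΩB + ΩA := by
    ext i j
    rw [← eA', Matrix.add_apply, hB', hA', hΩA, ← sum_add_distrib]
    refine sum_congr rfl fun l _ => ?_
    rw [← mul_add, ← Int.cast_add]
    congr 2
    simp only [hT, hK, j.isLt, if_true, add_tsub_cancel_left, not_lt.mpr (Nat.le_add_right g j),
      if_false]
    rcases lt_trichotomy (l : ℕ) (2 * j) with h | h | h
    · simp [h, h.le, h.ne, show (l : ℕ) ≠ 2 * j + 1 by omega]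
    · simp [h]
    · simp [h.not_gt, h.not_ge, h.ne']
  have uA : IsUnit ΩA := by
    rw [Matrix.isUnit_iff_isUnit_det, isUnit_iff_ne_zero, eA, Matrix.det_mul, Matrix.det_diagonal]
    refine mul_ne_zero (prod_ne_zero_iff.mpr fun i _ => mul_ne_zero (hx0 i) ?_) hV
    rw [← neg_sub]
    exact neg_ne_zero.mpr (hx1 i)
  have uB : IsUnit ΩB := by
    rw [Matrix.isUnit_iff_isUnit_det, isUnit_iff_ne_zero, eB, Matrix.det_mul, Matrix.det_mul,
      Matrix.det_diagonal, det_upperTriangular_one, mul_one]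
    exact mul_ne_zero (prod_ne_zero_iff.mpr fun i _ => hx1 i) hV
  refine ⟨uA, uB, eA' ▸ uB.neg, ?_⟩
  rw [eA', eB', inv_neg_mul_neg_add _ _ uA uB]
end

section
/- Write M · ᵗT₇,₁ = (A₁ | B₁), where A₁ and B₁ are the left and right 3×3 blocks of the product. Then A₁ is invertible and A₁^{−1} B₁ equals the matrix with rows: (4+ζ+2ζ²+2ζ³+ζ⁴+2ζ⁵, −1−2ζ−2ζ³−2ζ⁵, −1+ζ−ζ²), (−1−2ζ−2ζ³−2ζ⁵, −1+ζ−ζ²−ζ⁴−ζ⁵, 1+ζ³+ζ⁵), (−1+ζ−ζ², 1+ζ³+ζ⁵, 1+ζ²). (This is the period matrix τ₇,₁ of the curve y⁷ = x(1−x) with respect to the chord-slide symplectic basis.) -/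
open Finset

/-- The period matrix `τ₇,₁` of the curve `y⁷ = x(1-x)` with respect to the chord-slide
symplectic basis: writing `M ᵗT₇,₁ = (A₁ | B₁)` blockwise, `A₁` is invertible and
`A₁⁻¹ B₁` equals the explicit matrix in powers of `ζ = exp(2πi/7)`. -/
theorem period_matrix_C71 (ζ : ℂ) (hζ : ζ = Complex.exp (2 * Real.pi * Complex.I / 7))
    (M : Matrix (Fin 3) (Fin 6) ℂ)
    (hM : ∀ i j, M i j = 1 - ζ ^ (((i : ℕ) + 1) * ((j : ℕ) + 1)))
    (T71 : Matrix (Fin 6) (Fin 6) ℤ)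
    (hT71 : T71 = !![1, 0, 0, 0, 0, 0;
                     1, -1, 1, 0, 0, 0;
                     1, -1, 1, -1, 1, 0;
                     0, 1, 0, 0, 0, 0;
                     1, -1, 0, 1, 0, 0;
                     1, -1, 1, -1, 0, 1])
    (A1 B1 : Matrix (Fin 3) (Fin 3) ℂ)
    (hA1 : ∀ i j : Fin 3, A1 i j =
      ∑ l, M i l * ((T71 ⟨(j : ℕ), by have := j.isLt; omega⟩ l : ℤ) : ℂ))
    (hB1 : ∀ i j : Fin 3, B1 i j =
      ∑ l, M i l * ((T71 ⟨3 + (j : ℕ), by have := j.isLt; omega⟩ l : ℤ) : ℂ)) :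
    IsUnit A1 ∧
      A1⁻¹ * B1 =
        !![4 + ζ + 2 * ζ ^ 2 + 2 * ζ ^ 3 + ζ ^ 4 + 2 * ζ ^ 5,
             -1 - 2 * ζ - 2 * ζ ^ 3 - 2 * ζ ^ 5, -1 + ζ - ζ ^ 2;
           -1 - 2 * ζ - 2 * ζ ^ 3 - 2 * ζ ^ 5,
             -1 + ζ - ζ ^ 2 - ζ ^ 4 - ζ ^ 5, 1 + ζ ^ 3 + ζ ^ 5;
           -1 + ζ - ζ ^ 2, 1 + ζ ^ 3 + ζ ^ 5, 1 + ζ ^ 2] := by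
  have hprim : IsPrimitiveRoot ζ 7 := by
    rw [hζ]
    exact_mod_cast Complex.isPrimitiveRoot_exp 7 (by norm_num)
  have hsum : 1 + ζ + ζ ^ 2 + ζ ^ 3 + ζ ^ 4 + ζ ^ 5 + ζ ^ 6 = 0 := by
    simpa [Finset.sum_range_succ] using hprim.geom_sum_eq_zero (by norm_num)
  have h7 : ζ ^ 7 = 1 := hprim.pow_eq_one
  have hdet : A1.det * (-(1 + ζ ^ 2 + ζ ^ 3 + ζ ^ 5)) = 7 := by
    simp only [Matrix.det_fin_three, hA1, hM, hT71, Fin.sum_univ_six]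
    simp
    grind
  have hunit : IsUnit A1.det :=
    (left_ne_zero_of_mul (hdet.trans_ne (by norm_num))).isUnit
  refine ⟨(Matrix.isUnit_iff_isUnit_det A1).2 hunit, ?_⟩
  suffices h : B1 = A1 * _ by rw [h, Matrix.nonsing_inv_mul_cancel_left _ _ hunit]
  ext i j
  simp only [Matrix.mul_apply, Fin.sum_univ_three, hA1, hB1, hM, hT71, Fin.sum_univ_six]
  fin_cases i <;> fin_cases j <;> simp <;> grind
end

section
/- Write M₂ · ᵗT₇,₂ = (A₂ | B₂), where A₂ and B₂ are the left and right 3×3 blocks of the product. Then A₂ is invertible and A₂^{−1} B₂ = (1/4) · S, where S is the matrix with rows (6+3ξ, 4+2ξ, −2−ξ), (4+2ξ, 4+4ξ, −2ξ), (−2−ξ, −2ξ, 2+3ξ) and ξ = ζ + ζ² + ζ⁴ = (−1+√(−7))/2. (This is the period matrix τ₇,₂ of the Klein quartic y⁷ = x(1−x)².) -/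
open Finset

theorem exp_two_pi_I_div_seven_cyclotomic (ζ : ℂ)
    (hζ : ζ = Complex.exp (2 * Real.pi * Complex.I / 7)) :
    1 + ζ + ζ ^ 2 + ζ ^ 3 + ζ ^ 4 + ζ ^ 5 + ζ ^ 6 = 0 := by
  have hp : IsPrimitiveRoot ζ 7 := by
    rw [hζ]
    exact_mod_cast Complex.isPrimitiveRoot_exp 7 (by norm_num)
  simpa [Finset.sum_range_succ] using hp.geom_sum_eq_zero (by norm_num)

/-- The period matrix `τ₇,₂` of the Klein quartic `y⁷ = x(1-x)²`: writing
`M₂ ᵗT₇,₂ = (A₂ | B₂)` blockwise, `A₂` is invertible and `A₂⁻¹ B₂ = (1/4) S`, where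
`S` is the explicit matrix in `ξ = ζ + ζ² + ζ⁴` and `ζ = exp(2πi/7)`. -/
theorem period_matrix_C72 (ζ : ℂ) (hζ : ζ = Complex.exp (2 * Real.pi * Complex.I / 7))
    (e : Fin 3 → ℕ) (he : e = ![1, 2, 4])
    (M2 : Matrix (Fin 3) (Fin 6) ℂ)
    (hM2 : ∀ i j, M2 i j = 1 - ζ ^ (e i * ((j : ℕ) + 1)))
    (T72 : Matrix (Fin 6) (Fin 6) ℤ)
    (hT72 : T72 = !![1, 0, 0, 0, 0, 0;
                     -1, 1, 0, 0, 0, 0;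
                     0, 1, -1, 0, 1, 0;
                     0, 0, 1, 0, 0, 0;
                     0, 0, 0, 1, 0, 0;
                     -1, 1, 0, -1, 0, 1])
    (A2 B2 : Matrix (Fin 3) (Fin 3) ℂ)
    (hA2 : ∀ i j : Fin 3, A2 i j =
      ∑ l, M2 i l * ((T72 ⟨(j : ℕ), by have := j.isLt; omega⟩ l : ℤ) : ℂ))
    (hB2 : ∀ i j : Fin 3, B2 i j =
      ∑ l, M2 i l * ((T72 ⟨3 + (j : ℕ), by have := j.isLt; omega⟩ l : ℤ) : ℂ))
    (ξ : ℂ) (hξ : ξ = ζ + ζ ^ 2 + ζ ^ 4) :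
    IsUnit A2 ∧
      A2⁻¹ * B2 = (1 / 4 : ℂ) •
        !![6 + 3 * ξ, 4 + 2 * ξ, -2 - ξ;
           4 + 2 * ξ, 4 + 4 * ξ, -2 * ξ;
           -2 - ξ, -2 * ξ, 2 + 3 * ξ] := by
  have hc := exp_two_pi_I_div_seven_cyclotomic ζ hζ
  have h7 : ζ ^ 7 = 1 := by linear_combination (ζ - 1) * hc
  have hpow : ∀ n, ζ ^ n = ζ ^ (n % 7) := fun n => pow_eq_pow_mod n h7
  have hA : A2 = !![1 - ζ, ζ - ζ ^ 2, 1 - ζ ^ 2 + ζ ^ 3 - ζ ^ 5;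
                    1 - ζ ^ 2, ζ ^ 2 - ζ ^ 4, 1 - ζ ^ 4 + ζ ^ 6 - ζ ^ 3;
                    1 - ζ ^ 4, ζ ^ 4 - ζ, 1 - ζ + ζ ^ 5 - ζ ^ 6] := by
    ext i j
    rw [hA2]
    fin_cases i <;> fin_cases j <;>
      simp [Fin.sum_univ_succ, hM2, hT72, he, hpow 8, hpow 12, hpow 20, hpow 10] <;> ring
  have hB : B2 = !![1 - ζ ^ 3, 1 - ζ ^ 4, ζ - ζ ^ 2 + ζ ^ 4 - ζ ^ 6;
                    1 - ζ ^ 6, 1 - ζ, ζ ^ 2 - ζ ^ 4 + ζ - ζ ^ 5;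
                    1 - ζ ^ 5, 1 - ζ ^ 2, ζ ^ 4 - ζ + ζ ^ 2 - ζ ^ 3] := by
    ext i j
    rw [hB2]
    fin_cases i <;> fin_cases j <;>
      simp [Fin.sum_univ_succ, hM2, hT72, he, hpow 8, hpow 12, hpow 16, hpow 24] <;> ring
  have hdet : A2.det * (2 + ξ) = 28 := by
    rw [hA, Matrix.det_fin_three, hξ]
    simp
    grind
  have hunit : IsUnit A2.det := isUnit_iff_ne_zero.mpr fun h => by norm_num [h] at hdet
  refine ⟨(Matrix.isUnit_iff_isUnit_det A2).mpr hunit, ?_⟩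
  have hmul : B2 = A2 * ((1 / 4 : ℂ) •
      !![6 + 3 * ξ, 4 + 2 * ξ, -2 - ξ;
         4 + 2 * ξ, 4 + 4 * ξ, -2 * ξ;
         -2 - ξ, -2 * ξ, 2 + 3 * ξ]) := by
    rw [hA, hB, hξ]
    ext i j
    fin_cases i <;> fin_cases j <;> simp [Matrix.mul_apply, Fin.sum_univ_succ] <;> grind
  rw [hmul, ← Matrix.mul_assoc, Matrix.nonsing_inv_mul A2 hunit, Matrix.one_mul]
end

section
/- The determinant of A₂ equals 7(1 − ξ), where ξ = ζ + ζ² + ζ⁴. -/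
open Finset

/-- `det A₂ = 7(1 - ξ)` with `ξ = ζ + ζ² + ζ⁴`, where the `i`-th row of `A₂` is
`(1 - ζ^{e_i}, ζ^{e_i} - ζ^{2e_i}, 1 - ζ^{2e_i} + ζ^{3e_i} - ζ^{5e_i})`,
`(e₁,e₂,e₃) = (1,2,4)` and `ζ = exp(2πi/7)`. -/
theorem det_A2 (ζ : ℂ) (hζ : ζ = Complex.exp (2 * Real.pi * Complex.I / 7))
    (e : Fin 3 → ℕ) (he : e = ![1, 2, 4])
    (A2 : Matrix (Fin 3) (Fin 3) ℂ)
    (hA2 : ∀ i : Fin 3,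
      A2 i = ![1 - ζ ^ (e i), ζ ^ (e i) - ζ ^ (2 * e i),
               1 - ζ ^ (2 * e i) + ζ ^ (3 * e i) - ζ ^ (5 * e i)]) :
    A2.det = 7 * (1 - (ζ + ζ ^ 2 + ζ ^ 4)) := by
  have hprim : IsPrimitiveRoot ζ 7 := by
    rw [hζ]
    exact_mod_cast Complex.isPrimitiveRoot_exp 7 (by norm_num)
  have hcyc : 1 + ζ + ζ ^ 2 + ζ ^ 3 + ζ ^ 4 + ζ ^ 5 + ζ ^ 6 = 0 := by
    simpa [Finset.sum_range_succ] using hprim.geom_sum_eq_zero (by norm_num)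
  subst he
  rw [Matrix.det_fin_three]
  simp only [hA2, Matrix.cons_val]
  linear_combination
    (-7 + 14 * ζ - 7 * ζ ^ 3 + 7 * ζ ^ 4 - 8 * ζ ^ 5 + ζ ^ 6 - 3 * ζ ^ 7 + 9 * ζ ^ 8 - ζ ^ 9
      - 6 * ζ ^ 10 + 5 * ζ ^ 11 - 3 * ζ ^ 12 + ζ ^ 13 - ζ ^ 14 + 3 * ζ ^ 15 - 2 * ζ ^ 16
      - 2 * ζ ^ 17 + 3 * ζ ^ 18 - ζ ^ 19) * hcyc
end
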